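/- Let P be a d-dimensional polytope. Then the extension complexity of P equals d+2 if and only if P has exactly d+2 vertices or exactly d+2 facets. -/

import Mathlib

open Set

noncomputable section

/-- A polytope: the convex hull of a finite set of points. -/
def IsPolytope {N : ℕ} (P : Set (Fin N → ℝ)) : Prop :=
  ∃ S : Finset (Fin N → ℝ), P = convexHull ℝ (S : Set (Fin N → ℝ))

/-- Dimension of a set: the dimension of its affine hull (with `-1` for the empty set). -/
def pdim {N : ℕ} (P : Set (Fin N → ℝ)) : ℤ :=
  haveI := Classical.dec P.Nonempty
  if P.Nonempty then (Module.finrank ℝ (affineSpan ℝ P).direction : ℤ) else -1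

/-- `F` is a face of `P`: the subset of `P` where some linear functional bounded above on `P`
attains its maximum value.  This includes `∅` and `P` itself. -/
def IsFaceOf {N : ℕ} (F P : Set (Fin N → ℝ)) : Prop :=
  ∃ (c : Fin N → ℝ) (b : ℝ),
    (∀ x ∈ P, ∑ i, c i * x i ≤ b) ∧ F = {x ∈ P | ∑ i, c i * x i = b}

/-- A facet: a face of dimension one less than the polytope. -/
def IsFacetOf {N : ℕ} (F P : Set (Fin N → ℝ)) : Prop :=
  IsFaceOf F P ∧ pdim F + 1 = pdim P

/-- A ridge: a face of dimension two less than the polytope. -/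
def IsRidgeOf {N : ℕ} (F P : Set (Fin N → ℝ)) : Prop :=
  IsFaceOf F P ∧ pdim F + 2 = pdim P

def IsVertexOf {N : ℕ} (v : Fin N → ℝ) (P : Set (Fin N → ℝ)) : Prop :=
  IsFaceOf {v} P

def vertexSet {N : ℕ} (P : Set (Fin N → ℝ)) : Set (Fin N → ℝ) :=
  {v | IsVertexOf v P}

def vertexCount {N : ℕ} (P : Set (Fin N → ℝ)) : ℕ := (vertexSet P).ncard

def facetCount {N : ℕ} (P : Set (Fin N → ℝ)) : ℕ := {F | IsFacetOf F P}.ncard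

/-- Extension complexity: the minimal number of facets of a polytope (in any dimension)
admitting an affine projection onto `P`. -/
def xc {N : ℕ} (P : Set (Fin N → ℝ)) : ℕ :=
  sInf {n | ∃ (e : ℕ) (Q : Set (Fin e → ℝ)) (π : (Fin e → ℝ) →ᵃ[ℝ] (Fin N → ℝ)),
    IsPolytope Q ∧ π '' Q = P ∧ facetCount Q = n}

/-- Combinatorial equivalence: an inclusion-preserving bijection between face lattices. -/
def CombEquiv {M N : ℕ} (P : Set (Fin M → ℝ)) (Q : Set (Fin N → ℝ)) : Prop :=
  ∃ φ : {F : Set (Fin M → ℝ) // IsFaceOf F P} ≃ {G : Set (Fin N → ℝ) // IsFaceOf G Q},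
    ∀ F₁ F₂ : {F : Set (Fin M → ℝ) // IsFaceOf F P},
      F₁.1 ⊆ F₂.1 ↔ (φ F₁).1 ⊆ (φ F₂).1

/-- A full-dimensional `n`-simplex in `ℝ^n` with the origin in its (relative) interior. -/
def simplexF (n : ℕ) : Set (Fin n → ℝ) :=
  convexHull ℝ ((Set.range fun i : Fin n => Pi.single i (1 : ℝ)) ∪ {fun _ => -1})

/-- The Cartesian product `Δ_n × Δ_m`, realized in `ℝ^{n+m}`. -/
def prodP (n m : ℕ) : Set (Fin (n + m) → ℝ) :=
  {z | ∃ a ∈ simplexF n, ∃ b ∈ simplexF m, z = Fin.append a b}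

/-- The direct sum `Δ_n ⊕ Δ_m`, realized in `ℝ^{n+m}`. -/
def sumP (n m : ℕ) : Set (Fin (n + m) → ℝ) :=
  convexHull ℝ (((fun a : Fin n → ℝ => Fin.append a (0 : Fin m → ℝ)) '' simplexF n) ∪
    ((fun b : Fin m → ℝ => Fin.append (0 : Fin n → ℝ) b) '' simplexF m))

/-- The join `A ⋆ B` of two polytopes, realized in `ℝ^{p+q+1}` with the two copies
placed in skew affine subspaces. -/
def joinP {p q : ℕ} (A : Set (Fin p → ℝ)) (B : Set (Fin q → ℝ)) :
    Set (Fin (p + q + 1) → ℝ) :=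
  convexHull ℝ
    (((fun a : Fin p → ℝ =>
        Fin.append (Fin.append a (0 : Fin q → ℝ)) (fun _ : Fin 1 => (0 : ℝ))) '' A) ∪
     ((fun b : Fin q → ℝ =>
        Fin.append (Fin.append (0 : Fin p → ℝ) b) (fun _ : Fin 1 => (1 : ℝ))) '' B))

/-- The canonical `k`-fold iterated pyramid over `X`, realized in `ℝ^{p+k}`. -/
def pyrK {p : ℕ} (k : ℕ) (X : Set (Fin p → ℝ)) : Set (Fin (p + k) → ℝ) :=
  convexHull ℝ (((fun x : Fin p → ℝ => Fin.append x (0 : Fin k → ℝ)) '' X) ∪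
    Set.range (fun j : Fin k => Fin.append (0 : Fin p → ℝ) (Pi.single j (1 : ℝ))))

/-- Transport a subset of `ℝ^a` to `ℝ^b` along a proof that `a = b`. -/
def castSet {a b : ℕ} (h : a = b) (X : Set (Fin a → ℝ)) : Set (Fin b → ℝ) :=
  (fun x : Fin a → ℝ => fun i : Fin b => x (Fin.cast h.symm i)) '' X

/-- Projective equivalence of two subsets of `ℝ^N`: `Q` is the image of `P` under a
projective transformation `x ↦ (A x + b) / (⟨c, x⟩ + δ)` whose associated
`(N+1) × (N+1)` matrix is invertible and whose denominator is positive on `P`. -/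
def ProjEquiv {N : ℕ} (P Q : Set (Fin N → ℝ)) : Prop :=
  ∃ (A : (Fin N → ℝ) →ₗ[ℝ] (Fin N → ℝ)) (b c : Fin N → ℝ) (δ : ℝ),
    Function.Bijective
      (fun z : (Fin N → ℝ) × ℝ => (A z.1 + z.2 • b, (∑ i, c i * z.1 i) + δ * z.2)) ∧
    (∀ x ∈ P, 0 < (∑ i, c i * x i) + δ) ∧
    Q = (fun x : Fin N → ℝ => ((∑ i, c i * x i) + δ)⁻¹ • (A x + b)) '' P

/-- `P` is a pyramid with base `B`: the convex hull of `B` and a point outside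
the affine hull of `B`. -/
def IsPyramidOver {N : ℕ} (P B : Set (Fin N → ℝ)) : Prop :=
  ∃ a : Fin N → ℝ, a ∉ affineSpan ℝ B ∧ P = convexHull ℝ (B ∪ {a})

/-- `P` is a `k`-fold iterated pyramid over `B`. -/
def IsKFoldPyramidOver {N : ℕ} : ℕ → Set (Fin N → ℝ) → Set (Fin N → ℝ) → Prop
  | 0, P, B => P = B
  | k + 1, P, B => ∃ P' : Set (Fin N → ℝ), IsPyramidOver P P' ∧ IsKFoldPyramidOver k P' B

/-- `P` is a pyramid: the convex hull of one of its facets together with one more vertex. -/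
def IsPyramidPolytope {N : ℕ} (P : Set (Fin N → ℝ)) : Prop :=
  ∃ (F : Set (Fin N → ℝ)) (v : Fin N → ℝ),
    IsFacetOf F P ∧ IsVertexOf v P ∧ P = convexHull ℝ (F ∪ {v})

/-- A facet is pyramidal if it contains all vertices of the polytope but one. -/
def IsPyramidalFacet {N : ℕ} (F P : Set (Fin N → ℝ)) : Prop :=
  IsFacetOf F P ∧ ∃ v, IsVertexOf v P ∧ v ∉ F ∧ ∀ w, IsVertexOf w P → w ≠ v → w ∈ F

/-- The projection `π_d : ℝ^{d+1} → ℝ^d` forgetting the last coordinate. -/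
def projFun (d : ℕ) : (Fin (d + 1) → ℝ) → (Fin d → ℝ) :=
  fun x i => x i.castSucc

/-- `c` is an outer normal vector exposing the face `F` of `Q`. -/
def IsOuterNormal {N : ℕ} (Q F : Set (Fin N → ℝ)) (c : Fin N → ℝ) : Prop :=
  ∃ b : ℝ, (∀ x ∈ Q, ∑ i, c i * x i ≤ b) ∧ F = {x ∈ Q | ∑ i, c i * x i = b}

/-- An upper facet: outer normal with positive last coordinate. -/
def IsUpperFacet {d : ℕ} (F Q : Set (Fin (d + 1) → ℝ)) : Prop :=
  IsFacetOf F Q ∧ ∃ c, IsOuterNormal Q F c ∧ 0 < c (Fin.last d)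

/-- A lower facet: outer normal with negative last coordinate. -/
def IsLowerFacet {d : ℕ} (F Q : Set (Fin (d + 1) → ℝ)) : Prop :=
  IsFacetOf F Q ∧ ∃ c, IsOuterNormal Q F c ∧ c (Fin.last d) < 0

/-- A vertical facet: every outer normal has vanishing last coordinate. -/
def IsVerticalFacet {d : ℕ} (F Q : Set (Fin (d + 1) → ℝ)) : Prop :=
  IsFacetOf F Q ∧ ∀ c, IsOuterNormal Q F c → c (Fin.last d) = 0

/-- An equatorial ridge: a ridge that is the intersection of an upper and a lower facet. -/
def IsEquatorialRidge {d : ℕ} (F Q : Set (Fin (d + 1) → ℝ)) : Prop :=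
  IsRidgeOf F Q ∧ ∃ F₁ F₂ : Set (Fin (d + 1) → ℝ),
    IsUpperFacet F₁ Q ∧ IsLowerFacet F₂ Q ∧ F = F₁ ∩ F₂

/-- A face `F` of `Q` is preserved under the projection forgetting the last coordinate. -/
def PreservedFace {d : ℕ} (Q F : Set (Fin (d + 1) → ℝ)) : Prop :=
  IsFaceOf (projFun d '' F) (projFun d '' Q) ∧ projFun d ⁻¹' (projFun d '' F) ∩ Q = F

/-- A face `F` of `Q` is strictly preserved: preserved and of the same dimension as its image. -/
def StrictlyPreservedFace {d : ℕ} (Q F : Set (Fin (d + 1) → ℝ)) : Prop :=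
  PreservedFace Q F ∧ pdim (projFun d '' F) = pdim F

/-- A hexagon: a 2-dimensional polytope with exactly 6 vertices. -/
def IsHexagon {N : ℕ} (P : Set (Fin N → ℝ)) : Prop :=
  IsPolytope P ∧ pdim P = 2 ∧ vertexCount P = 6

/-- Three lines are concurrent: they share a common point, or they are pairwise parallel. -/
def ConcurrentLines {N : ℕ} (L₁ L₂ L₃ : AffineSubspace ℝ (Fin N → ℝ)) : Prop :=
  (∃ x, x ∈ L₁ ∧ x ∈ L₂ ∧ x ∈ L₃) ∨
    (AffineSubspace.Parallel L₁ L₂ ∧ AffineSubspace.Parallel L₂ L₃ ∧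
      AffineSubspace.Parallel L₁ L₃)

/-- A cyclic labeling of the vertices of a hexagon: consecutive points are joined by edges. -/
def CyclicLabeling {N : ℕ} (P : Set (Fin N → ℝ)) (p : Fin 6 → (Fin N → ℝ)) : Prop :=
  Function.Injective p ∧ Set.range p = vertexSet P ∧
    ∀ i : Fin 6, IsFaceOf (segment ℝ (p i) (p (i + 1))) P

/-- A Desarguian hexagon. -/
def Desarguian {N : ℕ} (P : Set (Fin N → ℝ)) : Prop :=
  ∃ p : Fin 6 → (Fin N → ℝ), CyclicLabeling P p ∧
    ConcurrentLines (affineSpan ℝ {p 0, p 1}) (affineSpan ℝ {p 5, p 2})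
      (affineSpan ℝ {p 3, p 4})

/-- A polytope is simplicial if every facet is a simplex. -/
def IsSimplicial {N : ℕ} (P : Set (Fin N → ℝ)) : Prop :=
  ∀ F : Set (Fin N → ℝ), IsFacetOf F P →
    ∃ S : Finset (Fin N → ℝ),
      AffineIndependent ℝ (Subtype.val : {x // x ∈ S} → (Fin N → ℝ)) ∧
      F = convexHull ℝ (S : Set (Fin N → ℝ))

section PolarDuality

open Module Filter Topology

theorem eq_zero_of_tight_eq_zero {ι E : Type*} [AddCommGroup E] [Module ℝ E] {s : Finset ι}
    {f : ι → E →ₗ[ℝ] ℝ} {w : E} (hw : w ∈ extremePoints ℝ {w | ∀ i ∈ s, f i w ≤ 1}) {u : E}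
    (hu : ∀ i ∈ s, f i w = 1 → f i u = 0) : u = 0 := by
  rw [mem_extremePoints] at hw
  obtain ⟨hwK, hext⟩ := hw
  have key : ∀ᶠ ε : ℝ in 𝓝[>] 0, ∀ i ∈ s, f i w + ε * |f i u| ≤ 1 := by
    rw [Filter.eventually_all_finset]
    intro i hi
    rcases (hwK i hi).eq_or_lt with h | h
    · simp [hu i hi h, h]
    · have hc : Tendsto (fun ε : ℝ => f i w + ε * |f i u|) (𝓝[>] 0) (𝓝 (f i w)) := by
        have : Continuous (fun ε : ℝ => f i w + ε * |f i u|) := by fun_prop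
        simpa using (this.tendsto 0).mono_left nhdsWithin_le_nhds
      exact (hc.eventually_lt_const h).mono fun _ h => h.le
  obtain ⟨ε, hε, hpos⟩ := (key.and self_mem_nhdsWithin).exists
  have hpos : 0 < ε := hpos
  have h1 := hext (w + ε • u) (fun i hi => by
      have := hε i hi
      have := mul_le_mul_of_nonneg_left (le_abs_self (f i u)) hpos.le
      simp only [map_add, map_smul, smul_eq_mul]
      linarith) (w - ε • u) (fun i hi => by
      have := hε i hi
      have := mul_le_mul_of_nonneg_left (neg_abs_le (f i u)) hpos.le
      simp only [map_sub, map_smul, smul_eq_mul]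
      linarith) ⟨1 / 2, 1 / 2, by norm_num, by norm_num, by norm_num, by module⟩
  have h2 : ε • u = 0 := by simpa using h1.1
  exact (smul_eq_zero.1 h2).resolve_left hpos.ne'

theorem injOn_tight {ι E : Type*} [AddCommGroup E] [Module ℝ E] (s : Finset ι)
    (f : ι → E →ₗ[ℝ] ℝ) :
    InjOn (fun w => s.filter fun i => f i w = 1)
      (extremePoints ℝ {w | ∀ i ∈ s, f i w ≤ 1}) := by
  intro w hw w' _ h
  refine sub_eq_zero.1 (eq_zero_of_tight_eq_zero hw fun i hi h1 => ?_)
  have : i ∈ s.filter fun i => f i w' = 1 := by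
    have h : (s.filter fun i => f i w = 1) = s.filter fun i => f i w' = 1 := h
    rw [← h]
    simp [hi, h1]
  simp [h1, (Finset.mem_filter.1 this).2]

theorem finite_extremePoints_halfspaces {ι E : Type*} [AddCommGroup E] [Module ℝ E]
    (s : Finset ι) (f : ι → E →ₗ[ℝ] ℝ) :
    (extremePoints ℝ {w | ∀ i ∈ s, f i w ≤ 1}).Finite :=
  Set.Finite.of_injOn (t := (s.powerset : Set (Finset ι)))
    (fun _ _ => Finset.mem_coe.2 (Finset.mem_powerset.2 (Finset.filter_subset _ s))) (injOn_tight s f) (Finset.finite_toSet _)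

theorem convexHull_extremePoints_eq {E : Type*} [NormedAddCommGroup E] [NormedSpace ℝ E]
    {K : Set E} (hK : IsCompact K) (hc : Convex ℝ K) (hf : (extremePoints ℝ K).Finite) :
    convexHull ℝ (extremePoints ℝ K) = K := by
  rw [← (hf.isClosed_convexHull ℝ).closure_eq, closure_convexHull_extremePoints hK hc]

variable {V : Type*} [NormedAddCommGroup V] [NormedSpace ℝ V]

theorem forall_convexHull_le_iff {S : Set V} (y : V →ₗ[ℝ] ℝ) (b : ℝ) :
    (∀ x ∈ convexHull ℝ S, y x ≤ b) ↔ ∀ x ∈ S, y x ≤ b :=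
  ⟨fun h x hx => h x (subset_convexHull ℝ S hx), fun h _ hx =>
    convexHull_min (t := {x | y x ≤ b}) h (convex_halfSpace_le y.isLinear b) hx⟩

theorem isCompact_polar [FiniteDimensional ℝ V] {S : Set V}
    (h0 : 0 ∈ interior (convexHull ℝ S)) :
    IsCompact {y : StrongDual ℝ V | ∀ x ∈ S, y x ≤ 1} := by
  refine Metric.isCompact_of_isClosed_isBounded ?_ ?_
  · simp only [ofPred_forall]
    refine isClosed_biInter fun x _ => isClosed_le (by fun_prop) continuous_const
  · obtain ⟨r, hr, hball⟩ := Metric.mem_nhds_iff.1 (mem_interior_iff_mem_nhds.1 h0)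
    rw [isBounded_iff_forall_norm_le]
    refine ⟨2 / r, fun y hy => ?_⟩
    have hle : ∀ x ∈ convexHull ℝ S, y x ≤ 1 :=
      (forall_convexHull_le_iff (y : V →ₗ[ℝ] ℝ) 1).2 hy
    refine y.opNorm_le_bound (by positivity) fun x => ?_
    rcases eq_or_ne x 0 with rfl | hx
    · simp
    have hx' : 0 < ‖x‖ := norm_pos_iff.2 hx
    have hmem : ∀ t : ℝ, |t| = r / 2 / ‖x‖ → y (t • x) ≤ 1 := fun t ht => hle _ <| hball <| by
      rw [mem_ball_zero_iff, norm_smul, Real.norm_eq_abs, ht, div_mul_cancel₀ _ hx'.ne']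
      linarith
    have hp : 0 < r / 2 / ‖x‖ := by positivity
    have h1 := hmem (r / 2 / ‖x‖) (abs_of_pos hp)
    have h2 := hmem (-(r / 2 / ‖x‖)) (by rw [abs_neg, abs_of_pos hp])
    simp only [map_smul, smul_eq_mul] at h1 h2
    have h3 : r / 2 / ‖x‖ * |y x| ≤ 1 := by
      rcases abs_cases (y x) with ⟨h, _⟩ | ⟨h, _⟩ <;> rw [h] <;> linarith
    rw [Real.norm_eq_abs]
    have h4 : |y x| ≤ 1 / (r / 2 / ‖x‖) := (le_div_iff₀' hp).2 h3
    calc |y x| ≤ _ := h4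
      _ = 2 / r * ‖x‖ := by field_simp

theorem mem_of_forall_polar_le {C : Set V} (hC : Convex ℝ C) (hcl : IsClosed C) (h0 : 0 ∈ C)
    {x : V} (hx : ∀ y : StrongDual ℝ V, (∀ z ∈ C, y z ≤ 1) → y x ≤ 1) : x ∈ C := by
  by_contra hxC
  obtain ⟨f, u, hu, hux⟩ := geometric_hahn_banach_closed_point hC hcl hxC
  have hu0 : 0 < u := by simpa using hu 0 h0
  have := hx (u⁻¹ • f) fun z hz => by
    simpa [inv_mul_le_iff₀ hu0] using (hu z hz).le
  simp only [smul_apply, smul_eq_mul, inv_mul_le_iff₀ hu0, mul_one] at this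
  linarith

theorem finrank_le_card_of_tight [FiniteDimensional ℝ V] (T : Finset (StrongDual ℝ V))
    (hT : ∀ u : V, (∀ y ∈ T, y u = 0) → u = 0) : finrank ℝ V ≤ T.card := by
  have hinj : Function.Injective
      (LinearMap.pi fun y : T => ((y : StrongDual ℝ V) : V →ₗ[ℝ] ℝ)) := by
    rw [← LinearMap.ker_eq_bot, LinearMap.ker_eq_bot']
    intro u hu
    exact hT u fun y hy => congrFun hu ⟨y, hy⟩
  simpa using LinearMap.finrank_le_finrank_of_injective hinj

theorem finrank_add_one_le_card {E : Type*} [NormedAddCommGroup E] [NormedSpace ℝ E]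
    [FiniteDimensional ℝ E] {T : Finset E}
    (h : (interior (convexHull ℝ (T : Set E))).Nonempty) : finrank ℝ E + 1 ≤ T.card := by
  classical
  have htop := interior_convexHull_nonempty_iff_affineSpan_eq_top.1 h
  obtain ⟨n, hn⟩ : ∃ n, T.card = n + 1 := Nat.exists_eq_succ_of_ne_zero fun h0 => by
    simp [Finset.card_eq_zero.1 h0] at h
  have := finrank_vectorSpan_image_finset_le ℝ id T hn
  rw [Finset.image_id, ← direction_affineSpan, htop, AffineSubspace.direction_top,
    finrank_top] at this
  omega

theorem finrank_vectorSpan_of_tight [FiniteDimensional ℝ V] {X : Set V} (hX : X.Nonempty)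
    {y : StrongDual ℝ V} (hy : ∀ x ∈ X, y x = 1)
    (h : ∀ u : StrongDual ℝ V, (∀ x ∈ X, u x = 0) → u = 0) :
    finrank ℝ (vectorSpan ℝ X) + 1 = finrank ℝ V := by
  obtain ⟨p, hp⟩ := hX
  have hle : vectorSpan ℝ X ≤ (y : V →ₗ[ℝ] ℝ).ker := by
    rw [vectorSpan_def, Submodule.span_le]
    rintro _ ⟨a, ha, b, hb, rfl⟩
    simp [hy a ha, hy b hb]
  have hker := Module.Dual.finrank_ker_add_one_of_ne_zero (f := (y : V →ₗ[ℝ] ℝ)) fun h0 => by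
    simpa [hy p hp] using LinearMap.congr_fun h0 p
  have htop : vectorSpan ℝ X ⊔ Submodule.span ℝ {p} = ⊤ := by
    by_contra hne
    obtain ⟨f, hf, hfk⟩ := Submodule.exists_le_ker_of_lt_top _ (lt_top_iff_ne_top.2 hne)
    refine hf (LinearMap.toContinuousLinearMap.injective ?_)
    rw [map_zero]
    refine h _ fun x hx => ?_
    have h1 : f (x - p) = 0 := hfk (Submodule.mem_sup_left (vsub_mem_vectorSpan ℝ hx hp))
    have h2 : f p = 0 :=
      hfk (Submodule.mem_sup_right (Submodule.mem_span_singleton_self p))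
    simpa [h2] using h1
  have h1 := Submodule.finrank_add_le_finrank_add_finrank (vectorSpan ℝ X)
    (Submodule.span ℝ {p})
  rw [htop, finrank_top] at h1
  have h2 : finrank ℝ (Submodule.span ℝ {p}) ≤ 1 := by
    simpa using finrank_span_le_card (R := ℝ) ({p} : Set V)
  have h3 := Submodule.finrank_mono hle
  omega

/-- The vertices of the polar of a polytope with the origin in its interior. -/
theorem exists_polar_vertices [FiniteDimensional ℝ V] (S : Finset V)
    (h0 : 0 ∈ interior (convexHull ℝ (S : Set V))) :
    ∃ Y : Finset (StrongDual ℝ V), finrank ℝ V + 1 ≤ Y.card ∧ (∀ y ∈ Y, ∀ x ∈ S, y x ≤ 1) ∧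
      (∀ y ∈ Y, ∀ u : StrongDual ℝ V, (∀ x ∈ S, y x = 1 → u x = 0) → u = 0) ∧
      (Y.card ≤ finrank ℝ V + 1 →
        ∃ T : Finset V, T.card ≤ finrank ℝ V + 1 ∧
          convexHull ℝ (S : Set V) = convexHull ℝ (T : Set V)) := by
  let ev : V → StrongDual ℝ V →ₗ[ℝ] ℝ := fun x =>
    (ContinuousLinearMap.apply ℝ ℝ x : StrongDual ℝ V →L[ℝ] ℝ)
  set K : Set (StrongDual ℝ V) := {y | ∀ x ∈ S, y x ≤ 1} with hK
  have hfin : (extremePoints ℝ K).Finite := finite_extremePoints_halfspaces S ev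
  have hconv : Convex ℝ K := by
    simp only [hK, ofPred_forall]
    exact convex_iInter₂ fun x _ => convex_halfSpace_le (ev x).isLinear 1
  have hKeq : convexHull ℝ (hfin.toFinset : Set (StrongDual ℝ V)) = K := by
    rw [hfin.coe_toFinset]
    exact convexHull_extremePoints_eq (isCompact_polar h0) hconv hfin
  have h0K : (0 : StrongDual ℝ V) ∈ interior K := by
    rw [mem_interior_iff_mem_nhds]
    have : ∀ᶠ y : StrongDual ℝ V in 𝓝 0, ∀ x ∈ S, y x ≤ 1 := by
      rw [Filter.eventually_all_finset]
      intro x _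
      have hc : Continuous fun y : StrongDual ℝ V => y x := by fun_prop
      exact ((hc.tendsto 0).eventually_lt_const (by simp)).mono fun _ h => h.le
    exact this
  have hmemK : ∀ y ∈ hfin.toFinset, y ∈ extremePoints ℝ K := fun y => hfin.mem_toFinset.1
  have hfr : finrank ℝ (StrongDual ℝ V) = finrank ℝ V := by
    rw [← (LinearMap.toContinuousLinearMap (𝕜 := ℝ) (E := V) (F' := ℝ)).finrank_eq]
    exact Subspace.dual_finrank_eq
  refine ⟨hfin.toFinset, ?_, fun y hy => (hmemK y hy).1, fun y hy u hu =>
    eq_zero_of_tight_eq_zero (f := ev) (hmemK y hy) hu, fun hcard => ?_⟩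
  · rw [← hfr]
    exact finrank_add_one_le_card ⟨0, by rwa [hKeq]⟩
  set Y := hfin.toFinset
  let fn : StrongDual ℝ V → V →ₗ[ℝ] ℝ := fun y => (y : V →ₗ[ℝ] ℝ)
  have hQ : convexHull ℝ (S : Set V) = {x | ∀ y ∈ Y, fn y x ≤ 1} := by
    apply Subset.antisymm
    · intro x hx y hy
      exact (forall_convexHull_le_iff (fn y) 1).2 (hmemK y hy).1 x hx
    · intro x hx
      refine mem_of_forall_polar_le (convex_convexHull ℝ _)
        (S.finite_toSet.isClosed_convexHull ℝ) (interior_subset h0) fun y hy => ?_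
      have hyK : y ∈ K := fun z hz => hy z (subset_convexHull ℝ _ hz)
      rw [← hKeq] at hyK
      exact (forall_convexHull_le_iff (ev x) 1).2 hx y hyK
  have hfinQ := finite_extremePoints_halfspaces Y fn
  rw [← hQ] at hfinQ
  refine ⟨hfinQ.toFinset, ?_, ?_⟩
  · have hmaps : ∀ x ∈ hfinQ.toFinset, (Y.filter fun y => fn y x = 1) ∈
        Y.powersetCard (finrank ℝ V) := by
      intro x hx
      rw [hfinQ.mem_toFinset] at hx
      have hx2 := hx
      rw [hQ] at hx2
      rw [Finset.mem_powersetCard]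
      refine ⟨Finset.filter_subset _ _, le_antisymm ?_ ?_⟩
      · have hlt : (Y.filter fun y => fn y x = 1).card < Y.card := by
          refine Finset.card_lt_card (Finset.filter_ssubset.2 ?_)
          by_contra! hall
          have : convexHull ℝ (Y : Set (StrongDual ℝ V)) ⊆ {y | ev x y = 1} :=
            convexHull_min hall (convex_hyperplane (ev x).isLinear 1)
          rw [hKeq] at this
          simpa using this (interior_subset h0K)
        omega
      · refine finrank_le_card_of_tight _ fun u hu => eq_zero_of_tight_eq_zero hx2 ?_
        intro y hy h1
        exact hu y (Finset.mem_filter.2 ⟨hy, h1⟩)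
    have hinj := injOn_tight Y fn
    rw [← hQ] at hinj
    refine (Finset.card_le_card_of_injOn _ hmaps (by simpa using hinj)).trans ?_
    rw [Finset.card_powersetCard]
    exact (Nat.choose_le_choose _ hcard).trans (by simp)
  · rw [hfinQ.coe_toFinset]
    exact (convexHull_extremePoints_eq (S.finite_toSet.isCompact_convexHull ℝ)
      (convex_convexHull ℝ _) hfinQ).symm

end PolarDuality

section Polytopes

open Module

variable {M N : ℕ}

theorem exists_coeff_eq (f : (Fin N → ℝ) →ₗ[ℝ] ℝ) :
    ∃ c : Fin N → ℝ, ∀ x, ∑ i, c i * x i = f x :=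
  ⟨fun i => f fun j => if i = j then 1 else 0, fun x => by
    rw [f.pi_apply_eq_sum_univ x]
    exact Finset.sum_congr rfl fun i _ => mul_comm _ _⟩

theorem isFaceOf_iff {F P : Set (Fin N → ℝ)} :
    IsFaceOf F P ↔ ∃ (f : (Fin N → ℝ) →ₗ[ℝ] ℝ) (b : ℝ),
      (∀ x ∈ P, f x ≤ b) ∧ F = {x ∈ P | f x = b} := by
  constructor
  · rintro ⟨c, b, h⟩
    exact ⟨∑ i, c i • LinearMap.proj i, b, by simpa using h⟩
  · rintro ⟨f, b, h⟩
    obtain ⟨c, hc⟩ := exists_coeff_eq f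
    exact ⟨c, b, by simpa only [hc] using h⟩

theorem IsFaceOf.subset {F P : Set (Fin N → ℝ)} (h : IsFaceOf F P) : F ⊆ P := by
  obtain ⟨c, b, -, rfl⟩ := h
  exact sep_subset _ _

theorem IsFaceOf.eq_convexHull {S : Finset (Fin N → ℝ)} {F : Set (Fin N → ℝ)}
    (h : IsFaceOf F (convexHull ℝ (S : Set (Fin N → ℝ)))) :
    F = convexHull ℝ (S ∩ F : Set (Fin N → ℝ)) := by
  obtain ⟨f, b, hle, hF⟩ := isFaceOf_iff.1 h
  have hconv : Convex ℝ F := by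
    rw [hF]
    exact (convex_convexHull ℝ _).inter (convex_hyperplane f.isLinear b)
  refine Subset.antisymm (fun x hx => ?_) (convexHull_min inter_subset_right hconv)
  rw [hF] at hx
  obtain ⟨w, hw0, hw1, hwx⟩ := Finset.mem_convexHull'.1 hx.1
  have hS : ∀ y ∈ S, f y ≤ b := fun y hy => hle y (subset_convexHull ℝ _ hy)
  have hsum : ∑ y ∈ S, w y * (b - f y) = 0 := by
    have : f x = ∑ y ∈ S, w y * f y := by simp [← hwx]
    simp only [mul_sub, Finset.sum_sub_distrib, ← Finset.sum_mul, hw1, one_mul, ← this, hx.2,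
      sub_self]
  rw [Finset.sum_eq_zero_iff_of_nonneg fun y hy =>
    mul_nonneg (hw0 y hy) (sub_nonneg.2 (hS y hy))] at hsum
  classical
  rw [← Finset.sum_filter_ne_zero] at hw1
  have hwx' : ∑ y ∈ S with w y ≠ 0, w y • y = x := by
    rw [← hwx, Finset.sum_filter]
    refine Finset.sum_congr rfl fun y _ => ?_
    by_cases h0 : w y = 0 <;> simp [h0]
  rw [← hwx']
  refine (convex_convexHull ℝ _).sum_mem (fun y hy => hw0 y (Finset.mem_filter.1 hy).1) hw1
    fun y hy => subset_convexHull ℝ _ ?_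
  obtain ⟨hyS, hy0⟩ := Finset.mem_filter.1 hy
  refine ⟨hyS, hF ▸ ⟨subset_convexHull ℝ _ hyS, ?_⟩⟩
  have := (mul_eq_zero.1 (hsum y hyS)).resolve_left hy0
  linarith

theorem injOn_inter_faces (S : Finset (Fin N → ℝ)) :
    InjOn (fun F : Set (Fin N → ℝ) => (S : Set (Fin N → ℝ)) ∩ F)
      {F | IsFaceOf F (convexHull ℝ (S : Set (Fin N → ℝ)))} := by
  intro F hF G hG h
  have h : (S : Set (Fin N → ℝ)) ∩ F = (S : Set (Fin N → ℝ)) ∩ G := h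
  rw [IsFaceOf.eq_convexHull hF, h, ← IsFaceOf.eq_convexHull hG]

theorem IsPolytope.finite_facets {P : Set (Fin N → ℝ)} (hP : IsPolytope P) :
    {F | IsFacetOf F P}.Finite := by
  obtain ⟨S, rfl⟩ := hP
  exact Set.Finite.of_injOn (t := 𝒫 (S : Set (Fin N → ℝ))) (fun _ _ => inter_subset_left)
    ((injOn_inter_faces S).mono fun _ hF => hF.1) S.finite_toSet.finite_subsets

theorem pdim_of_nonempty {P : Set (Fin N → ℝ)} (h : P.Nonempty) :
    pdim P = finrank ℝ (vectorSpan ℝ P) := by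
  rw [pdim, if_pos h, direction_affineSpan]

@[simp]
theorem pdim_empty : pdim (∅ : Set (Fin N → ℝ)) = -1 := by
  simp [pdim]

theorem pdim_convexHull_lt_card (T : Finset (Fin N → ℝ)) :
    pdim (convexHull ℝ (T : Set (Fin N → ℝ))) < T.card := by
  rcases T.eq_empty_or_nonempty with rfl | hT
  · simp
  · obtain ⟨n, hn⟩ := Nat.exists_eq_succ_of_ne_zero hT.card_pos.ne'
    have := finrank_vectorSpan_image_finset_le ℝ id T hn
    rw [Finset.image_id] at this
    rw [pdim_of_nonempty (by simpa using hT), ← direction_affineSpan, affineSpan_convexHull,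
      direction_affineSpan, hn]
    omega

theorem pdim_image_le (π : (Fin M → ℝ) →ᵃ[ℝ] (Fin N → ℝ)) (X : Set (Fin M → ℝ)) :
    pdim (π '' X) ≤ pdim X := by
  rcases X.eq_empty_or_nonempty with rfl | hX
  · simp
  · rw [pdim_of_nonempty hX, pdim_of_nonempty (hX.image _), ← AffineMap.map_vectorSpan]
    exact_mod_cast Submodule.finrank_map_le _ _

theorem pdim_image_eq_of_subset {π : (Fin M → ℝ) →ᵃ[ℝ] (Fin N → ℝ)} {Q X : Set (Fin M → ℝ)}
    (h : pdim (π '' Q) = pdim Q) (hX : X ⊆ Q) : pdim (π '' X) = pdim X := by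
  rcases X.eq_empty_or_nonempty with rfl | hne
  · simp
  have hQ := hne.mono hX
  rw [pdim_of_nonempty hQ, pdim_of_nonempty (hQ.image _), ← AffineMap.map_vectorSpan,
    Nat.cast_inj] at h
  rw [pdim_of_nonempty hne, pdim_of_nonempty (hne.image _), ← AffineMap.map_vectorSpan,
    Nat.cast_inj]
  have hinj : Function.Injective (π.linear.domRestrict (vectorSpan ℝ Q)) := by
    rw [← LinearMap.ker_eq_bot, ← Submodule.finrank_eq_zero]
    have := (π.linear.domRestrict (vectorSpan ℝ Q)).finrank_range_add_finrank_ker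
    rw [LinearMap.range_domRestrict] at this
    omega
  have hinjX : Function.Injective (π.linear.domRestrict (vectorSpan ℝ X)) :=
    hinj.comp (Submodule.inclusion_injective (vectorSpan_mono ℝ hX))
  rw [← LinearMap.range_domRestrict, LinearMap.finrank_range_of_inj hinjX]

theorem facetCount_image_le {π : (Fin M → ℝ) →ᵃ[ℝ] (Fin N → ℝ)} {Q : Set (Fin M → ℝ)}
    (hQ : IsPolytope Q) (h : pdim (π '' Q) = pdim Q) : facetCount (π '' Q) ≤ facetCount Q := by
  have himg : ∀ F ⊆ π '' Q, π '' (Q ∩ π ⁻¹' F) = F := fun F hF => by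
    rw [image_inter_preimage, inter_eq_right.2 hF]
  refine ncard_le_ncard_of_injOn (fun F => Q ∩ π ⁻¹' F) (fun F hF => ?_) (fun F hF G hG hFG => ?_)
    hQ.finite_facets
  · refine ⟨?_, ?_⟩
    · obtain ⟨f, b, hle, hF'⟩ := isFaceOf_iff.1 hF.1
      have hπ : ∀ x, f (π x) = f (π.linear x) + f (π 0) := fun x => by
        rw [← map_add]
        exact congrArg f (congrFun π.decomp x)
      refine isFaceOf_iff.2 ⟨f ∘ₗ π.linear, b - f (π 0), fun x hx => ?_, ?_⟩
      · have := hle _ (mem_image_of_mem π hx)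
        rw [hπ] at this
        simpa using by linarith
      · ext x
        simp only [hF', mem_inter_iff, mem_preimage, mem_ofPred_eq, LinearMap.comp_apply,
          eq_sub_iff_add_eq, ← hπ]
        exact ⟨fun hx => ⟨hx.1, hx.2.2⟩, fun hx => ⟨hx.1, mem_image_of_mem _ hx.1, hx.2⟩⟩
    · rw [← pdim_image_eq_of_subset h inter_subset_left, himg F hF.1.subset, hF.2, h]
  · rw [← himg F hF.1.subset, ← himg G hG.1.subset]
    exact congrArg _ hFG

theorem facetCount_convexHull_le_card {T : Finset (Fin N → ℝ)} (hT : T.Nonempty)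
    (hdim : (T.card : ℤ) ≤ pdim (convexHull ℝ (T : Set (Fin N → ℝ))) + 1) :
    facetCount (convexHull ℝ (T : Set (Fin N → ℝ))) ≤ T.card := by
  classical
  have hcard : (T.powersetCard (T.card - 1)).card = T.card := by
    rw [Finset.card_powersetCard, Nat.choose_symm hT.card_pos, Nat.choose_one_right]
  rw [← hcard, ← Set.ncard_coe_finset]
  refine ncard_le_ncard_of_injOn (fun F => T.filter (· ∈ F)) (fun F hF => ?_)
    (fun F hF G hG h => ?_)
  · have hF' : F = convexHull ℝ (T.filter (· ∈ F) : Finset (Fin N → ℝ)) := by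
      conv_lhs => rw [hF.1.eq_convexHull]
      congr 1
      ext
      simp
    have h1 := pdim_convexHull_lt_card (T.filter (· ∈ F))
    rw [← hF'] at h1
    have h2 := hF.2
    have h3 : (T.filter (· ∈ F)).card < T.card := by
      refine Finset.card_lt_card ((Finset.filter_subset _ _).ssubset_of_ne fun he => ?_)
      rw [he] at hF'
      rw [← hF'] at h2
      omega
    rw [Finset.mem_coe, Finset.mem_powersetCard]
    exact ⟨Finset.filter_subset _ _, by omega⟩
  · refine injOn_inter_faces T hF.1 hG.1 ?_
    ext x
    have := Finset.ext_iff.1 h x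
    simpa using this

theorem IsPolytope.facetCount_ge {Q : Set (Fin N → ℝ)} {k : ℕ} (hQ : IsPolytope Q)
    (hk : pdim Q = k) :
    k + 1 ≤ facetCount Q ∧ (facetCount Q ≤ k + 1 →
      ∃ T : Finset (Fin N → ℝ), T.card ≤ k + 1 ∧ Q = convexHull ℝ (T : Set (Fin N → ℝ))) := by
  classical
  obtain ⟨S, hS⟩ := hQ
  have hne : Q.Nonempty := by
    by_contra h
    rw [not_nonempty_iff_eq_empty.1 h, pdim_empty] at hk
    omega
  have hconv : Convex ℝ Q := hS ▸ convex_convexHull ℝ _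
  obtain ⟨x₀, hx₀⟩ := (intrinsicInterior_nonempty hconv).2 hne
  obtain ⟨x₁, hx₁, rfl⟩ := mem_intrinsicInterior.1 hx₀
  set V := (affineSpan ℝ Q).direction
  have : Nonempty (affineSpan ℝ Q) := ⟨x₁⟩
  have hfin : finrank ℝ V = k := by
    rw [pdim_of_nonempty hne, ← direction_affineSpan] at hk
    exact_mod_cast hk
  let ι : V →ᵃ[ℝ] (Fin N → ℝ) := V.subtype.toAffineMap + AffineMap.const ℝ V (x₁ : Fin N → ℝ)
  have hι : ∀ v : V, ι v = v + x₁ := fun v => rfl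
  have hinj : Function.Injective ι := fun v w h => by
    simpa [hι] using h
  have hrange : ∀ x ∈ Q, x ∈ range ι := fun x hx =>
    ⟨⟨x - x₁, AffineSubspace.vsub_mem_direction (subset_affineSpan ℝ Q hx) x₁.2⟩, by simp [hι]⟩
  have hnhds : (0 : V) ∈ interior (ι ⁻¹' Q) := by
    have : ι ⁻¹' Q = Homeomorph.vaddConst x₁ ⁻¹' (Subtype.val ⁻¹' Q) := rfl
    rw [this, ← Homeomorph.preimage_interior, mem_preimage]
    simpa using hx₁
  let S' : Finset V := S.preimage ι hinj.injOn
  have hS' : ι '' S' = S := by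
    rw [Finset.coe_preimage, image_preimage_eq_iff]
    exact fun x hx => hrange x (hS ▸ subset_convexHull ℝ _ hx)
  have hQ' : ι '' convexHull ℝ (S' : Set V) = Q := by rw [AffineMap.image_convexHull, hS', hS]
  have hpre : ι ⁻¹' Q = convexHull ℝ (S' : Set V) := by
    rw [← hQ', preimage_image_eq _ hinj]
  rw [hpre] at hnhds
  obtain ⟨Y, hYcard, hYle, hYtight, hYsimp⟩ := exists_polar_vertices S' hnhds
  rw [hfin] at hYcard hYsimp
  choose G hG using fun y : StrongDual ℝ V => LinearMap.exists_extend (y : V →ₗ[ℝ] ℝ)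
  have hGι : ∀ y v, G y (ι v) = y v + G y x₁ := fun y v => by
    rw [hι, map_add]
    exact congrArg (· + _) (LinearMap.congr_fun (hG y) v)
  let Φ : StrongDual ℝ V → Set (Fin N → ℝ) := fun y => {x ∈ Q | G y x = 1 + G y x₁}
  have hΦ : ∀ y, Φ y = ι '' {v ∈ convexHull ℝ (S' : Set V) | y v = 1} := fun y => by
    ext x
    constructor
    · rintro ⟨hx, h1⟩
      obtain ⟨v, hv, rfl⟩ := hQ'.symm ▸ hx
      exact ⟨v, ⟨hv, by simpa [hGι] using h1⟩, rfl⟩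
    · rintro ⟨v, ⟨hv, h1⟩, rfl⟩
      exact ⟨hQ' ▸ mem_image_of_mem _ hv, by rw [hGι, h1]⟩
  have hfacet : ∀ y ∈ Y, IsFacetOf (Φ y) Q := fun y hy => by
    refine ⟨isFaceOf_iff.2 ⟨G y, 1 + G y x₁, fun x hx => ?_, rfl⟩, ?_⟩
    · obtain ⟨v, hv, rfl⟩ := hQ'.symm ▸ hx
      have := (forall_convexHull_le_iff (y : V →ₗ[ℝ] ℝ) 1).2 (hYle y hy) v hv
      rw [hGι]
      simpa using this
    · have htight : ∀ u : StrongDual ℝ V,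
          (∀ v ∈ {v ∈ convexHull ℝ (S' : Set V) | y v = 1}, u v = 0) → u = 0 := fun u hu =>
        hYtight y hy u fun x hx h1 => hu x ⟨subset_convexHull ℝ _ hx, h1⟩
      rw [hk, hΦ]
      rcases Set.eq_empty_or_nonempty {v ∈ convexHull ℝ (S' : Set V) | y v = 1} with he | hX
      · rw [he] at htight ⊢
        have hsub : Subsingleton V := by
          by_contra hns
          rw [not_subsingleton_iff_nontrivial] at hns
          obtain ⟨v, hv⟩ := exists_ne (0 : V)
          obtain ⟨f, -, hf⟩ := exists_dual_vector ℝ v (norm_ne_zero_iff.2 hv)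
          rw [htight f (by simp)] at hf
          exact hv (norm_eq_zero.1 hf.symm)
        rw [finrank_zero_of_subsingleton] at hfin
        simp [← hfin]
      · have := finrank_vectorSpan_of_tight hX (fun _ h => h.2) htight
        rw [pdim_of_nonempty (hX.image _), ← AffineMap.map_vectorSpan]
        have hlin : Function.Injective ι.linear := ι.linear_injective_iff.2 hinj
        rw [← (Submodule.equivMapOfInjective _ hlin _).finrank_eq]
        exact_mod_cast this.trans hfin
  have hΦinj : InjOn Φ Y := fun y hy z hz h => by
    refine sub_eq_zero.1 (hYtight y hy _ fun x hx h1 => ?_)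
    have hmem : ι x ∈ Φ z := by
      rw [← h, hΦ]
      exact ⟨x, ⟨subset_convexHull ℝ _ hx, h1⟩, rfl⟩
    have := hmem.2
    rw [hGι] at this
    simp [h1, show z x = 1 by linarith]
  have hle : Y.card ≤ facetCount Q := by
    rw [← Set.ncard_coe_finset]
    exact ncard_le_ncard_of_injOn Φ hfacet hΦinj (IsPolytope.finite_facets ⟨S, hS⟩)
  refine ⟨hYcard.trans hle, fun hcard => ?_⟩
  obtain ⟨T, hT, hTS⟩ := hYsimp (hle.trans hcard)
  refine ⟨T.image ι, Finset.card_image_le.trans hT, ?_⟩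
  rw [Finset.coe_image, ← AffineMap.image_convexHull, ← hTS, hQ']

theorem vertexSet_convexHull_subset (T : Finset (Fin N → ℝ)) :
    vertexSet (convexHull ℝ (T : Set (Fin N → ℝ))) ⊆ T := by
  intro v hv
  by_contra hvT
  have := IsFaceOf.eq_convexHull hv
  rw [inter_singleton_eq_empty.2 hvT, convexHull_empty] at this
  exact singleton_ne_empty v this

theorem vertexCount_convexHull_le_card (T : Finset (Fin N → ℝ)) :
    vertexCount (convexHull ℝ (T : Set (Fin N → ℝ))) ≤ T.card := by
  rw [← Set.ncard_coe_finset]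
  exact ncard_le_ncard (vertexSet_convexHull_subset T)

theorem IsPolytope.exists_eq_convexHull_vertexSet {P : Set (Fin N → ℝ)} (hP : IsPolytope P) :
    ∃ T : Finset (Fin N → ℝ), T.card = vertexCount P ∧
      P = convexHull ℝ (T : Set (Fin N → ℝ)) := by
  classical
  obtain ⟨S, hS⟩ := hP
  induction S using Finset.strongInduction with
  | H S ih =>
    by_cases h : ∃ s ∈ S, s ∈ convexHull ℝ ((S.erase s : Finset _) : Set (Fin N → ℝ))
    · obtain ⟨s, hs, hmem⟩ := h
      refine ih (S.erase s) (Finset.erase_ssubset hs) (hS.trans (Subset.antisymm ?_ ?_))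
      · refine convexHull_min (fun x hx => ?_) (convex_convexHull ℝ _)
        by_cases hxs : x = s
        · exact hxs ▸ hmem
        · exact subset_convexHull ℝ _ (by simpa [hxs] using hx)
      · exact convexHull_mono (by simp)
    · push Not at h
      refine ⟨S, ?_, hS⟩
      rw [vertexCount, ← Set.ncard_coe_finset]
      congr 1
      refine Subset.antisymm (fun s hs => ?_) (hS ▸ vertexSet_convexHull_subset S)
      obtain ⟨f, u, hu, hus⟩ := geometric_hahn_banach_closed_point (convex_convexHull ℝ _)
        ((S.erase s).finite_toSet.isClosed_convexHull ℝ) (h s hs)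
      have hlt : ∀ x ∈ S, x ≠ s → f x < f s := fun x hx hxs =>
        (hu x (subset_convexHull ℝ _ (by simpa [hxs] using hx))).trans hus
      have hle : ∀ x ∈ P, f x ≤ f s := by
        rw [hS]
        refine (forall_convexHull_le_iff (f : (Fin N → ℝ) →ₗ[ℝ] ℝ) (f s)).2 fun x hx => ?_
        by_cases hxs : x = s
        · exact (congrArg f hxs).le
        · exact (hlt x hx hxs).le
      have hface : IsFaceOf {x ∈ P | f x = f s} P :=
        isFaceOf_iff.2 ⟨(f : (Fin N → ℝ) →ₗ[ℝ] ℝ), f s, hle, rfl⟩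
      have hsingle : {x ∈ P | f x = f s} = {s} := by
        have hS' : (S : Set (Fin N → ℝ)) ∩ {x ∈ P | f x = f s} = {s} := by
          ext x
          constructor
          · rintro ⟨hx, -, hfx⟩
            by_contra hxs
            exact (hlt x hx hxs).ne hfx
          · rintro rfl
            exact ⟨hs, hS ▸ subset_convexHull ℝ _ hs, rfl⟩
        have hface' := hface
        nth_rewrite 2 [hS] at hface'
        rw [hface'.eq_convexHull, hS', convexHull_singleton]
      exact show IsFaceOf {s} P from hsingle ▸ hface

end Polytopes

section ExtensionComplexity

variable {N : ℕ}

theorem IsPolytope.exists_xc_extension {P : Set (Fin N → ℝ)} (hP : IsPolytope P) :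
    ∃ (e : ℕ) (Q : Set (Fin e → ℝ)) (π : (Fin e → ℝ) →ᵃ[ℝ] (Fin N → ℝ)),
      IsPolytope Q ∧ π '' Q = P ∧ facetCount Q = xc P :=
  Nat.sInf_mem (s := {n | ∃ (e : ℕ) (Q : Set (Fin e → ℝ)) (π : (Fin e → ℝ) →ᵃ[ℝ] (Fin N → ℝ)),
    IsPolytope Q ∧ π '' Q = P ∧ facetCount Q = n})
    ⟨_, N, P, AffineMap.id ℝ _, hP, by simp, rfl⟩

theorem IsPolytope.xc_le_facetCount {P : Set (Fin N → ℝ)} (hP : IsPolytope P) :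
    xc P ≤ facetCount P :=
  Nat.sInf_le ⟨N, P, AffineMap.id ℝ _, hP, by simp, rfl⟩

theorem xc_convexHull_le_card {T : Finset (Fin N → ℝ)} (hT : T.Nonempty) :
    xc (convexHull ℝ (T : Set (Fin N → ℝ))) ≤ T.card := by
  classical
  let v : Fin T.card → Fin N → ℝ := fun i => T.equivFin.symm i
  let b : Fin T.card → Fin T.card → ℝ := fun i => Pi.single i 1
  have hind : AffineIndependent ℝ b := by
    have hb : b = Pi.basisFun ℝ (Fin T.card) := funext fun i => by simp [b]
    rw [hb]
    exact (Pi.basisFun ℝ (Fin T.card)).linearIndependent.affineIndependent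
  let B : Finset (Fin T.card → ℝ) := Finset.univ.image b
  have hBcard : B.card = T.card := by
    rw [Finset.card_image_of_injective _ hind.injective, Finset.card_univ, Fintype.card_fin]
  have hB : B.Nonempty := by rw [← Finset.card_pos, hBcard]; exact hT.card_pos
  have hdim : (B.card : ℤ) ≤ pdim (convexHull ℝ (B : Set (Fin T.card → ℝ))) + 1 := by
    obtain ⟨n, hn⟩ := Nat.exists_eq_succ_of_ne_zero hT.card_pos.ne'
    rw [pdim_of_nonempty (by simpa using hB), ← direction_affineSpan, affineSpan_convexHull,
      direction_affineSpan, hBcard, Finset.coe_image, Finset.coe_univ, image_univ,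
      hind.finrank_vectorSpan (n := n) (by simpa using hn), hn]
    simp
  refine le_trans (Nat.sInf_le ⟨T.card, _, (Fintype.linearCombination ℝ v).toAffineMap,
    ⟨B, rfl⟩, ?_, rfl⟩) ((facetCount_convexHull_le_card hB hdim).trans hBcard.le)
  rw [AffineMap.image_convexHull]
  congr 1
  ext x
  simp only [B, b, Finset.coe_image, Finset.coe_univ, image_univ, LinearMap.coe_toAffineMap,
    ← range_comp, mem_range, Function.comp_apply, Fintype.linearCombination_apply_single, one_smul]
  constructor
  · rintro ⟨i, rfl⟩
    exact (T.equivFin.symm i).2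
  · intro hx
    exact ⟨T.equivFin ⟨x, hx⟩, by simp [v]⟩

end ExtensionComplexity

theorem xc_eq_dim_add_two_iff (N d : ℕ) (P : Set (Fin N → ℝ))
    (hP : IsPolytope P) (hd : pdim P = d) :
    xc P = d + 2 ↔ (vertexCount P = d + 2 ∨ facetCount P = d + 2) := by
  classical
  have hne : P.Nonempty := by
    by_contra h
    rw [not_nonempty_iff_eq_empty.1 h, pdim_empty] at hd
    omega
  obtain ⟨V, hVcard, hV⟩ := hP.exists_eq_convexHull_vertexSet
  have hxcV : xc P ≤ vertexCount P := by
    have hVne : V.Nonempty := by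
      rw [hV] at hne
      simpa using hne
    calc xc P = xc (convexHull ℝ (V : Set (Fin N → ℝ))) := by rw [← hV]
      _ ≤ V.card := xc_convexHull_le_card hVne
      _ = vertexCount P := hVcard
  have hVdim : d + 1 ≤ vertexCount P := by
    have := pdim_convexHull_lt_card V
    rw [← hV, hd, hVcard] at this
    omega
  have hxcF := hP.xc_le_facetCount
  obtain ⟨e, Q, π, hQ, hπ, hQxc⟩ := hP.exists_xc_extension
  have hdimle : (d : ℤ) ≤ pdim Q := by
    rw [← hd, ← hπ]
    exact pdim_image_le π Q
  obtain ⟨k, hk⟩ := Int.eq_ofNat_of_zero_le ((Int.natCast_nonneg d).trans hdimle)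
  obtain ⟨hge, hsimplex⟩ := hQ.facetCount_ge hk
  have hvertex : facetCount Q ≤ k + 1 → vertexCount P ≤ k + 1 := fun h => by
    obtain ⟨T, hT, hQT⟩ := hsimplex h
    have hPT : P = convexHull ℝ ((T.image π : Finset _) : Set (Fin N → ℝ)) := by
      rw [Finset.coe_image, ← AffineMap.image_convexHull, ← hQT, hπ]
    calc vertexCount P = vertexCount (convexHull ℝ ((T.image π : Finset _) : Set (Fin N → ℝ))) := by
          rw [← hPT]
      _ ≤ (T.image π).card := vertexCount_convexHull_le_card _
      _ ≤ k + 1 := Finset.card_image_le.trans hT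
  have hfacet : k = d → facetCount P ≤ facetCount Q := fun h => by
    rw [← hπ]
    exact facetCount_image_le hQ (by rw [hπ, hd, hk, h])
  have hPfacet : vertexCount P ≤ d + 1 → facetCount P ≤ d + 1 := fun h => by
    have hcard : V.card = d + 1 := by omega
    have := facetCount_convexHull_le_card (T := V) (Finset.card_pos.1 (by omega)) (by
      rw [← hV, hd, hcard]
      push_cast
      rfl)
    rwa [← hV, hcard] at this
  omega

end
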